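/- arXiv:1412.8252 — 2 statements merged into one kernel-verified Lean document; each statement's English description precedes it below -/
import Mathlib

section
/- For every real ν with |ν| > 1, one has p_l^m(ν) ≠ 0 for all l ≥ m and lim_{l→∞} q_l^m(ν)/p_l^m(ν) = 0. -/
open MeasureTheory Filter

/-- Legendre polynomial via Rodrigues' formula. -/
noncomputable def legendreP (l : ℕ) (x : ℝ) : ℝ :=
  (1 / (2 ^ l * (Nat.factorial l : ℝ))) *
    iteratedDeriv l (fun y : ℝ => (y ^ 2 - 1) ^ l) x

/-- `p_l^m(μ) = √((l−m)!/(l+m)!) (d/dμ)^m P_l(μ)`; it vanishes for `l < m`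
(in particular the convention `p_{m−1}^m = 0` holds). -/
noncomputable def pml (m l : ℕ) (μ : ℝ) : ℝ :=
  Real.sqrt ((Nat.factorial (l - m) : ℝ) / (Nat.factorial (l + m) : ℝ)) *
    iteratedDeriv m (legendreP l) μ

/-- `q_l^m(w) = (1/2) ∫_{−1}^{1} p_l^m(μ)/(w−μ) (1−μ²)^m dμ`. -/
noncomputable def qml (m l : ℕ) (w : ℝ) : ℝ :=
  (1 / 2) * ∫ μ in (-1 : ℝ)..1, pml m l μ / (w - μ) * (1 - μ ^ 2) ^ m

/-- `h_l = 2l+1 − ϖ β_l` for `l ≤ L`, and `h_l = 2l+1` for `l > L`. -/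
noncomputable def hcoef (ϖ : ℝ) (β : ℕ → ℝ) (L l : ℕ) : ℝ :=
  if l ≤ L then 2 * l + 1 - ϖ * β l else 2 * l + 1

/-- Auxiliary recursion: `chandraAux ϖ β L m ν n = g_{m+n}^m(ν)`, built from the
initial value `g_m^m(ν) = √((2m)!)/(2^m m!)`, the convention `g_{m−1}^m = 0`, and the
three-term recurrence `ν h_l g_l^m = √((l+1)²−m²) g_{l+1}^m + √(l²−m²) g_{l−1}^m`. -/
noncomputable def chandraAux (ϖ : ℝ) (β : ℕ → ℝ) (L m : ℕ) (ν : ℝ) : ℕ → ℝ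
  | 0 => Real.sqrt (Nat.factorial (2 * m)) / (2 ^ m * Nat.factorial m)
  | 1 => ν * hcoef ϖ β L m *
      (Real.sqrt (Nat.factorial (2 * m)) / (2 ^ m * Nat.factorial m)) /
      Real.sqrt (((m : ℝ) + 1) ^ 2 - (m : ℝ) ^ 2)
  | n + 2 =>
      (ν * hcoef ϖ β L (m + n + 1) * chandraAux ϖ β L m ν (n + 1) -
          Real.sqrt (((m + n + 1 : ℕ) : ℝ) ^ 2 - (m : ℝ) ^ 2) * chandraAux ϖ β L m ν n) /
        Real.sqrt (((m + n + 2 : ℕ) : ℝ) ^ 2 - (m : ℝ) ^ 2)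

/-- The normalized Chandrasekhar polynomial `g_l^m(ν)` (with value `0` for `l < m`). -/
noncomputable def gml (ϖ : ℝ) (β : ℕ → ℝ) (L m l : ℕ) (ν : ℝ) : ℝ :=
  if l < m then 0 else chandraAux ϖ β L m ν (l - m)

/-- `g^m(ν,μ) = Σ_{l=m}^{L} β_l p_l^m(μ) g_l^m(ν)`. -/
noncomputable def gfun (ϖ : ℝ) (β : ℕ → ℝ) (L m : ℕ) (ν μ : ℝ) : ℝ :=
  ∑ l ∈ Finset.Icc m L, β l * pml m l μ * gml ϖ β L m l ν

/-- `Λ^m(w) = 1 − (ϖ w/2) ∫_{−1}^{1} g^m(w,μ)/(w−μ) (1−μ²)^m dμ`. -/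
noncomputable def Lam (ϖ : ℝ) (β : ℕ → ℝ) (L m : ℕ) (w : ℝ) : ℝ :=
  1 - ϖ * w / 2 * ∫ μ in (-1 : ℝ)..1, gfun ϖ β L m w μ / (w - μ) * (1 - μ ^ 2) ^ m

/-- The off-diagonal entry `b_l = √((l²−m²)/(h_l h_{l−1}))`. -/
noncomputable def bcoef (ϖ : ℝ) (β : ℕ → ℝ) (L m l : ℕ) : ℝ :=
  Real.sqrt (((l : ℝ) ^ 2 - (m : ℝ) ^ 2) / (hcoef ϖ β L l * hcoef ϖ β L (l - 1)))

/-- The symmetric tridiagonal matrix `B(m)` with rows/columns indexed by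
`l ∈ {m, …, l_B}` (here `l = m + i` for `i : Fin (l_B − m + 1)`), zero diagonal and
off-diagonal entries `B(m)_{l,l−1} = B(m)_{l−1,l} = b_l`. -/
noncomputable def Bmat (ϖ : ℝ) (β : ℕ → ℝ) (L m lB : ℕ) :
    Matrix (Fin (lB - m + 1)) (Fin (lB - m + 1)) ℝ :=
  fun i j =>
    if (i : ℕ) + 1 = (j : ℕ) then bcoef ϖ β L m (m + j)
    else if (j : ℕ) + 1 = (i : ℕ) then bcoef ϖ β L m (m + i)
    else 0

section

open Polynomial

/-- The `(l+m)`-th derivative of `(X² − 1)^l`, which is `2^l l!` times the `m`-th derivative of the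
Legendre polynomial. -/
noncomputable def rodriguesPoly (l m : ℕ) : ℝ[X] :=
  derivative^[l + m] ((X ^ 2 - 1) ^ l)

theorem iteratedDeriv_polynomial_eval (p : ℝ[X]) (k : ℕ) :
    iteratedDeriv k (fun x => p.eval x) = fun x => (derivative^[k] p).eval x := by
  induction k with
  | zero => simp
  | succ k ih =>
    rw [iteratedDeriv_succ, ih]
    ext x
    rw [Polynomial.deriv, Function.iterate_succ_apply']

theorem pml_eq (m l : ℕ) (x : ℝ) :
    pml m l x = Real.sqrt ((Nat.factorial (l - m) : ℝ) / (Nat.factorial (l + m) : ℝ)) *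
      (1 / (2 ^ l * (Nat.factorial l : ℝ))) * (rodriguesPoly l m).eval x := by
  have h : legendreP l = fun x =>
      (C (1 / (2 ^ l * (Nat.factorial l : ℝ))) * derivative^[l] ((X ^ 2 - 1) ^ l)).eval x := by
    ext y
    have h0 : (fun y : ℝ => (y ^ 2 - 1) ^ l) = fun y => ((X ^ 2 - 1 : ℝ[X]) ^ l).eval y := by
      ext; simp
    rw [legendreP, h0, iteratedDeriv_polynomial_eval, eval_mul, eval_C]
  rw [pml, h, iteratedDeriv_polynomial_eval, iterate_derivative_C_mul,
    ← Function.iterate_add_apply, rodriguesPoly, add_comm m l]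
  simp only [eval_mul, eval_C]
  ring

theorem iterate_derivative_ode (l k : ℕ) :
    (X ^ 2 - 1 : ℝ[X]) * derivative^[k + 2] ((X ^ 2 - 1) ^ l)
      + C (2 * (k + 1 - l) : ℝ) * X * derivative^[k + 1] ((X ^ 2 - 1) ^ l)
      + C ((k + 1) * (k - 2 * l) : ℝ) * derivative^[k] ((X ^ 2 - 1) ^ l) = 0 := by
  induction k with
  | zero =>
    have h : (X ^ 2 - 1 : ℝ[X]) * derivative ((X ^ 2 - 1) ^ l)
        = C (2 * l : ℝ) * X * (X ^ 2 - 1) ^ l := by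
      cases l with
      | zero => simp
      | succ l => simp [derivative_pow]; ring
    have h' := congrArg derivative h
    simp only [derivative_mul, derivative_sub, derivative_one, derivative_C, derivative_X,
      derivative_X_pow] at h'
    simp only [Function.iterate_succ_apply', Function.iterate_zero, id]
    simp only [map_mul, map_add, map_sub, map_natCast, map_ofNat, map_one] at h' ⊢
    push_cast at h' ⊢
    linear_combination h'
  | succ k ih =>
    have h' := congrArg derivative ih
    simp only [derivative_mul, derivative_add, derivative_sub, derivative_one, derivative_C,
      derivative_X, derivative_X_pow, derivative_zero,
      ← Function.iterate_succ_apply' (f := ⇑(derivative (R := ℝ)))] at h'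
    simp only [map_mul, map_add, map_sub, map_natCast, map_ofNat, map_one] at h' ⊢
    push_cast at h' ⊢
    linear_combination h'

theorem rodriguesPoly_ode (l m : ℕ) (x : ℝ) :
    (x ^ 2 - 1) * (derivative (derivative (rodriguesPoly l m))).eval x
      + 2 * (m + 1) * x * (derivative (rodriguesPoly l m)).eval x
      = (l + m + 1) * (l - m) * (rodriguesPoly l m).eval x := by
  have h := congrArg (eval x) (iterate_derivative_ode l (l + m))
  simp only [Function.iterate_succ_apply'] at h
  simp at h
  simp only [rodriguesPoly]
  linear_combination h

theorem rodriguesPoly_eval_neg (l m : ℕ) (x : ℝ) :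
    |(rodriguesPoly l m).eval (-x)| = |(rodriguesPoly l m).eval x| := by
  have h (k : ℕ) : (derivative^[k] ((X ^ 2 - 1 : ℝ[X]) ^ l)).comp (-X)
      = (-1) ^ k * derivative^[k] ((X ^ 2 - 1 : ℝ[X]) ^ l) := by
    induction k with
    | zero => simp
    | succ k ih =>
      have h' := congrArg derivative ih
      have e : ((-1 : ℝ[X]) ^ k) = C ((-1) ^ k) := by simp
      rw [derivative_comp, e, derivative_C_mul, ← e] at h'
      simp only [Function.iterate_succ_apply', derivative_neg, derivative_X] at h' ⊢
      linear_combination -h'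
  have h' := congrArg (eval x) (h (l + m))
  simp only [eval_comp, eval_neg, eval_X, eval_mul, eval_pow, eval_one] at h'
  rw [rodriguesPoly, h', abs_mul]
  simp

/-- The Taylor coefficients of `rodriguesPoly l m` at `1` are natural numbers. -/
theorem exists_natPoly_rodriguesPoly (l m : ℕ) (hml : m ≤ l) :
    ∃ N : ℕ[X], 0 < N.coeff 0 ∧
      (rodriguesPoly l m).comp (X + 1) = N.map (Nat.castRingHom ℝ) := by
  refine ⟨derivative^[l + m] (X ^ l * (X + C 2) ^ l), ?_, ?_⟩
  · rw [coeff_iterate_derivative, zero_add, add_comm l m, coeff_X_pow_mul, coeff_X_add_C_pow,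
      smul_eq_mul, Nat.cast_id]
    have := Nat.choose_pos hml
    have := Nat.descFactorial_self (m + l) ▸ Nat.factorial_pos (m + l)
    positivity
  · have h (k : ℕ) (p : ℝ[X]) :
        (derivative^[k] p).comp (X + 1) = derivative^[k] (p.comp (X + 1)) := by
      induction k with
      | zero => simp
      | succ k ih => simp [Function.iterate_succ_apply', ← ih, derivative_comp]
    rw [rodriguesPoly, h, ← iterate_derivative_map]
    congr 1
    simp [← mul_pow]
    ring

theorem rodriguesPoly_eval_one_pos (l m : ℕ) (hml : m ≤ l) :
    0 < (rodriguesPoly l m).eval 1 := by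
  obtain ⟨N, h0, hN⟩ := exists_natPoly_rodriguesPoly l m hml
  have h := congrArg (eval 0) hN
  rw [← coeff_zero_eq_eval_zero (N.map _), coeff_map] at h
  simp at h
  rw [h]
  exact_mod_cast h0

/-- Beyond `1` the polynomial lies above its tangent line at `1`. -/
theorem rodriguesPoly_tangent_le (l m : ℕ) (hml : m ≤ l) (t : ℝ) (ht : 0 ≤ t) :
    (rodriguesPoly l m).eval 1 * (1 + t * ((l + m + 1) * (l - m) / (2 * (m + 1))))
      ≤ (rodriguesPoly l m).eval (1 + t) := by
  obtain ⟨N, h0, hN⟩ := exists_natPoly_rodriguesPoly l m hml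
  have ode := rodriguesPoly_ode l m 1
  have h (s : ℝ) := congrArg (eval s) hN
  have h' := congrArg (eval 0) (congrArg derivative hN)
  have e : N.map (Nat.castRingHom ℝ) = (N.divX.divX.map (Nat.castRingHom ℝ) * X
      + C (N.coeff 1 : ℝ)) * X + C (N.coeff 0 : ℝ) := by
    conv_lhs => rw [← divX_mul_X_add N, ← divX_mul_X_add N.divX]
    simp
  have hpos : 0 ≤ (N.divX.divX.map (Nat.castRingHom ℝ)).eval t := by
    rw [eval_map, eval₂_eq_sum_range]
    exact Finset.sum_nonneg fun i _ => by simp; positivity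
  have h1 := h t
  have h2 := h 0
  rw [e] at h' h1 h2
  simp [derivative_comp] at h' h1 h2
  rw [add_comm 1 t, h1]
  have h3 : (N.coeff 1 : ℝ) = (rodriguesPoly l m).eval 1 *
      ((l + m + 1) * (l - m) / (2 * (m + 1))) := by
    rw [← h']
    field_simp
    linear_combination ode
  rw [mul_add, mul_left_comm, ← h3, mul_one, h2]
  nlinarith [mul_nonneg hpos (mul_nonneg ht ht)]

theorem abs_rodriguesPoly_le (l m : ℕ) (hml : m < l) (x : ℝ) (hx : |x| ≤ 1) :
    |(rodriguesPoly l m).eval x| ≤ (rodriguesPoly l m).eval 1 := by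
  wlog hx0 : 0 ≤ x generalizing x
  · rw [← rodriguesPoly_eval_neg]
    exact this (-x) (by rwa [abs_neg]) (by linarith)
  set R := rodriguesPoly l m
  have hlam : (0 : ℝ) < (l + m + 1) * (l - m) := by
    have : (m : ℝ) < l := by exact_mod_cast hml
    exact mul_pos (by positivity) (by linarith)
  set lam : ℝ := (l + m + 1) * (l - m)
  let E : ℝ[X] := C lam * R ^ 2 + (1 - X ^ 2) * (derivative R) ^ 2
  have hE (y : ℝ) : deriv (fun z => E.eval z) y
      = 2 * (2 * m + 1) * y * ((derivative R).eval y) ^ 2 := by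
    rw [Polynomial.deriv]
    have := rodriguesPoly_ode l m y
    simp only [E]
    simp [derivative_pow]
    linear_combination (-2 * (derivative R).eval y) * this
  have hmono : MonotoneOn (fun z => E.eval z) (Set.Icc 0 1) := by
    refine monotoneOn_of_deriv_nonneg (convex_Icc 0 1) E.continuous.continuousOn
      E.differentiable.differentiableOn fun y hy => ?_
    rw [interior_Icc] at hy
    rw [hE]
    have := hy.1
    positivity
  have hx1 := (abs_le.1 hx).2
  have h := hmono ⟨hx0, hx1⟩ ⟨zero_le_one, le_rfl⟩ hx1
  simp [E] at h
  refine abs_le_of_sq_le_sq ?_ (rodriguesPoly_eval_one_pos l m hml.le).le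
  refine le_of_mul_le_mul_left ?_ hlam
  have : 0 ≤ (1 - x ^ 2) * (derivative R).eval x ^ 2 :=
    mul_nonneg (by nlinarith) (sq_nonneg _)
  linarith

end

theorem le_abs_rodriguesPoly (l m : ℕ) (hml : m ≤ l) (x : ℝ) (hx : 1 ≤ |x|) :
    (rodriguesPoly l m).eval 1 *
      (1 + (|x| - 1) * ((l + m + 1) * (l - m) / (2 * (m + 1)))) ≤
      |(rodriguesPoly l m).eval x| := by
  have h := rodriguesPoly_tangent_le l m hml (|x| - 1) (by linarith)
  rw [add_sub_cancel] at h
  refine h.trans ((le_abs_self _).trans_eq ?_)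
  rcases abs_choice x with hc | hc <;> rw [hc]
  exact rodriguesPoly_eval_neg l m x

theorem pml_ne_zero (m l : ℕ) (hml : m ≤ l) (ν : ℝ) (hν : 1 < |ν|) : pml m l ν ≠ 0 := by
  rw [pml_eq]
  refine mul_ne_zero (by positivity) (abs_pos.1 (lt_of_lt_of_le ?_
    (le_abs_rodriguesPoly l m hml ν hν.le)))
  have : (m : ℝ) ≤ l := by exact_mod_cast hml
  have h1 := sub_nonneg.2 this
  have h2 := sub_pos.2 hν
  exact mul_pos (rodriguesPoly_eval_one_pos l m hml) (by positivity)

theorem abs_qml_div_pml_le (m l : ℕ) (hml : m < l) (ν : ℝ) (hν : 1 < |ν|) :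
    |qml m l ν / pml m l ν| ≤
      (|ν| - 1)⁻¹ * (1 + (|ν| - 1) * ((l + m + 1) * (l - m) / (2 * (m + 1))))⁻¹ := by
  have hml' : (m : ℝ) ≤ l := by exact_mod_cast hml.le
  have h1 := sub_nonneg.2 hml'
  have h2 := sub_pos.2 hν
  have hR := rodriguesPoly_eval_one_pos l m hml.le
  have hlow := le_abs_rodriguesPoly l m hml.le ν hν.le
  have hp := abs_pos.2 (pml_ne_zero m l hml.le ν hν)
  set G : ℝ := 1 + (|ν| - 1) * ((l + m + 1) * (l - m) / (2 * (m + 1)))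
  have hGpos : 0 < G := by positivity
  have hbound : ∀ μ ∈ Set.uIoc (-1 : ℝ) 1, ‖pml m l μ / (ν - μ) * (1 - μ ^ 2) ^ m‖ ≤
      (|pml m l ν| * G⁻¹) * (|ν| - 1)⁻¹ := by
    intro μ hμ
    rw [Set.uIoc_of_le (by norm_num)] at hμ
    have hμ1 : |μ| ≤ 1 := abs_le.2 ⟨hμ.1.le, hμ.2⟩
    have hμ2 : μ ^ 2 ≤ 1 := (sq_le_one_iff_abs_le_one μ).2 hμ1
    have hw : |(1 - μ ^ 2) ^ m| ≤ 1 := by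
      rw [abs_pow]
      exact pow_le_one₀ (abs_nonneg _) (abs_le.2 ⟨by linarith, by nlinarith⟩)
    have hd : |ν| - 1 ≤ |ν - μ| := by linarith [abs_sub_abs_le_abs_sub ν μ]
    have hpm : |pml m l μ| ≤ |pml m l ν| * G⁻¹ := by
      rw [← div_eq_mul_inv, le_div_iff₀ hGpos, pml_eq m l μ, pml_eq m l ν,
        abs_mul _ ((rodriguesPoly l m).eval μ), abs_mul _ ((rodriguesPoly l m).eval ν), mul_assoc]
      refine mul_le_mul_of_nonneg_left (le_trans ?_ hlow) (abs_nonneg _)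
      exact mul_le_mul_of_nonneg_right (abs_rodriguesPoly_le l m hml μ hμ1) hGpos.le
    rw [Real.norm_eq_abs, abs_mul, abs_div, div_eq_mul_inv]
    calc _ ≤ |pml m l μ| * |ν - μ|⁻¹ * 1 := by gcongr
      _ ≤ _ := by rw [mul_one]; gcongr
  have hint := intervalIntegral.norm_integral_le_of_norm_le_const hbound
  rw [Real.norm_eq_abs] at hint
  rw [abs_div, div_le_iff₀ hp, qml, abs_mul]
  norm_num at hint ⊢
  linarith

theorem tendsto_qml_div_pml (m : ℕ) (ν : ℝ) (hν : 1 < |ν|) :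
    Tendsto (fun l : ℕ => qml m l ν / pml m l ν) atTop (nhds 0) := by
  have h2 := sub_pos.2 hν
  have hlin : Tendsto (fun l : ℕ => (l : ℝ) - m) atTop atTop :=
    tendsto_atTop_add_const_right _ _ tendsto_natCast_atTop_atTop
  have hprod : Tendsto (fun l : ℕ => ((l : ℝ) + m + 1) * (l - m)) atTop atTop := by
    refine Tendsto.atTop_mul_atTop₀ ?_ hlin
    exact tendsto_atTop_add_const_right _ _
      (tendsto_atTop_add_const_right _ _ tendsto_natCast_atTop_atTop)
  have hG : Tendsto (fun l : ℕ =>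
      1 + (|ν| - 1) * (((l : ℝ) + m + 1) * (l - m) / (2 * (m + 1)))) atTop atTop :=
    tendsto_atTop_add_const_left _ _
      ((hprod.atTop_div_const (by positivity)).const_mul_atTop h2)
  refine squeeze_zero_norm' ?_ (by simpa using hG.inv_tendsto_atTop.const_mul (|ν| - 1)⁻¹)
  filter_upwards [eventually_gt_atTop m] with l hl
  exact abs_qml_div_pml_le m l hl ν hν

/-- for `|ν| > 1`, `p_l^m(ν) ≠ 0` for all `l ≥ m` and
`q_l^m(ν)/p_l^m(ν) → 0` as `l → ∞`. -/
theorem stmt_10 (m : ℕ) (ν : ℝ) (hν : 1 < |ν|) :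
    (∀ l : ℕ, m ≤ l → pml m l ν ≠ 0) ∧
      Tendsto (fun l : ℕ => qml m l ν / pml m l ν) atTop (nhds 0) :=
  ⟨fun l hl => pml_ne_zero m l hl ν hν, tendsto_qml_div_pml m ν hν⟩
end

section
/- (Three-term recurrence for the normalized derivatives of Legendre polynomials.) For every integer l ≥ m and every real μ, √(l² − m²) p_{l−1}^m(μ) − (2l+1) μ p_l^m(μ) + √((l+1)² − m²) p_{l+1}^m(μ) = 0. -/
open MeasureTheory Filter

open Polynomial in
theorem iteratedDeriv_eval_eq (n : ℕ) (p : ℝ[X]) :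
    iteratedDeriv n (fun x => p.eval x) = fun x => (derivative^[n] p).eval x := by
  induction n with
  | zero => simp
  | succ n ih =>
    rw [iteratedDeriv_succ, ih, Function.iterate_succ_apply']
    ext x
    exact Polynomial.deriv _

open Polynomial in
theorem iteratedDeriv_legendreP (m l : ℕ) (x : ℝ) :
    iteratedDeriv m (legendreP l) x =
      1 / (2 ^ l * (Nat.factorial l : ℝ)) *
        (derivative^[l + m] ((X ^ 2 - 1 : ℝ[X]) ^ l)).eval x := by
  have h : legendreP l = fun x => (C (1 / (2 ^ l * (Nat.factorial l : ℝ))) *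
      derivative^[l] ((X ^ 2 - 1 : ℝ[X]) ^ l)).eval x := by
    ext x
    have hpow : (fun y : ℝ => (y ^ 2 - 1) ^ l) =
        fun y => ((X ^ 2 - 1 : ℝ[X]) ^ l).eval y := by
      ext y
      simp
    rw [legendreP, hpow, iteratedDeriv_eval_eq, eval_mul, eval_C]
  rw [h, iteratedDeriv_eval_eq, add_comm l m, Function.iterate_add_apply]
  simp only [iterate_derivative_C_mul, eval_mul, eval_C]

open Polynomial in
theorem iterate_derivative_sq_sub_one_pow_succ (n k : ℕ) (x : ℝ) :
    (derivative^[k + 2] ((X ^ 2 - 1 : ℝ[X]) ^ (n + 1))).eval x =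
      2 * (n + 1) * (x * (derivative^[k + 1] ((X ^ 2 - 1 : ℝ[X]) ^ n)).eval x +
        (k + 1) * (derivative^[k] ((X ^ 2 - 1 : ℝ[X]) ^ n)).eval x) := by
  have h : derivative ((X ^ 2 - 1 : ℝ[X]) ^ (n + 1)) =
      C (2 * (n + 1) : ℝ) * ((X ^ 2 - 1 : ℝ[X]) ^ n * X) := by
    simp [derivative_pow]
    ring
  rw [Function.iterate_succ_apply, h, iterate_derivative_C_mul, iterate_derivative_mul_X]
  simp only [eval_mul, eval_C, eval_add, eval_X, nsmul_eq_mul, eval_natCast,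
    Nat.add_sub_cancel]
  push_cast
  ring

open Polynomial in
theorem iterate_derivative_sq_sub_one_pow_add_two (n k : ℕ) (x : ℝ) :
    (derivative^[k + 2] ((X ^ 2 - 1 : ℝ[X]) ^ (n + 2))).eval x =
      2 * (n + 2) * (2 * n + 3) * (derivative^[k] ((X ^ 2 - 1 : ℝ[X]) ^ (n + 1))).eval x +
        4 * (n + 1) * (n + 2) * (derivative^[k] ((X ^ 2 - 1 : ℝ[X]) ^ n)).eval x := by
  have h : derivative (derivative ((X ^ 2 - 1 : ℝ[X]) ^ (n + 2))) =
      C (2 * (n + 2) * (2 * n + 3) : ℝ) * (X ^ 2 - 1 : ℝ[X]) ^ (n + 1) +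
        C (4 * (n + 1) * (n + 2) : ℝ) * (X ^ 2 - 1 : ℝ[X]) ^ n := by
    simp only [derivative_pow, derivative_mul, derivative_sub, derivative_X, derivative_one,
      C_mul, C_add, C_ofNat, C_1, map_natCast]
    push_cast
    simp
    ring
  rw [Function.iterate_succ_apply, Function.iterate_succ_apply, h, iterate_map_add,
    iterate_derivative_C_mul, iterate_derivative_C_mul]
  simp

/-- Bonnet's recurrence for the `m`-th derivatives of the Legendre polynomials. -/
theorem iteratedDeriv_legendreP_bonnet (m n : ℕ) (x : ℝ) :
    ((n : ℝ) + 2 - m) * iteratedDeriv m (legendreP (n + 2)) x =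
      (2 * n + 3) * x * iteratedDeriv m (legendreP (n + 1)) x -
        (n + 1 + m) * iteratedDeriv m (legendreP n) x := by
  have h1 := iterate_derivative_sq_sub_one_pow_succ (n + 1) (n + m) x
  have h2 := iterate_derivative_sq_sub_one_pow_add_two n (n + m) x
  simp only [iteratedDeriv_legendreP]
  rw [show n + 2 + m = n + m + 2 by ring, show n + 1 + m = n + m + 1 by ring]
  rw [show n + 1 + 1 = n + 2 by ring] at h1
  push_cast at h1
  have hf : (Nat.factorial n : ℝ) ≠ 0 := by positivity
  have hn1 : (n : ℝ) + 1 ≠ 0 := by positivity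
  have hn2 : (n : ℝ) + 2 ≠ 0 := by positivity
  rw [show (n + 2).factorial = (n + 2) * ((n + 1) * n.factorial) from rfl,
    show (n + 1).factorial = (n + 1) * n.factorial from rfl]
  have hp : (2 : ℝ) ^ n ≠ 0 := by positivity
  rw [pow_add (2 : ℝ) n 2, pow_add (2 : ℝ) n 1]
  generalize (2 : ℝ) ^ n = t at hp ⊢
  push_cast
  field_simp
  linear_combination (2 * (n : ℝ) + 3) * h1 - ((n : ℝ) + m + 1) * h2

open Polynomial in
theorem iteratedDeriv_legendreP_eq_zero {m l : ℕ} (h : l < m) (x : ℝ) :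
    iteratedDeriv m (legendreP l) x = 0 := by
  rw [iteratedDeriv_legendreP, iterate_derivative_eq_zero, eval_zero, mul_zero]
  have h2 : ((X ^ 2 - 1 : ℝ[X]) ^ l).natDegree ≤ l * 2 :=
    natDegree_pow_le_of_le l (by compute_degree)
  omega

theorem sqrt_mul_sqrt_factorial_succ {m l : ℕ} (hl : m ≤ l) :
    Real.sqrt (((l : ℝ) + 1) ^ 2 - (m : ℝ) ^ 2) *
        Real.sqrt ((Nat.factorial (l + 1 - m) : ℝ) / (Nat.factorial (l + 1 + m) : ℝ)) =
      ((l : ℝ) + 1 - m) *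
        Real.sqrt ((Nat.factorial (l - m) : ℝ) / (Nat.factorial (l + m) : ℝ)) := by
  obtain ⟨d, rfl⟩ := Nat.exists_eq_add_of_le hl
  rw [show m + d + 1 - m = d + 1 by omega, show m + d - m = d by omega,
    show m + d + 1 + m = m + d + m + 1 by ring, Nat.factorial_succ, Nat.factorial_succ]
  push_cast
  rw [← Real.sqrt_mul (by nlinarith [(Nat.cast_nonneg m : (0 : ℝ) ≤ m),
    (Nat.cast_nonneg d : (0 : ℝ) ≤ d)]),
    show (m : ℝ) + d + 1 - m = Real.sqrt ((d + 1 : ℝ) ^ 2) by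
      rw [Real.sqrt_sq (by positivity)]; ring,
    ← Real.sqrt_mul (by positivity)]
  congr 1
  have hf : (Nat.factorial (m + d + m) : ℝ) ≠ 0 := by positivity
  have hs : (m : ℝ) + d + m + 1 ≠ 0 := by positivity
  field_simp
  ring

theorem sqrt_mul_sqrt_factorial {m l : ℕ} (hl : m ≤ l) :
    Real.sqrt (((l : ℝ) + 1) ^ 2 - (m : ℝ) ^ 2) *
        Real.sqrt ((Nat.factorial (l - m) : ℝ) / (Nat.factorial (l + m) : ℝ)) =
      ((l : ℝ) + 1 + m) *
        Real.sqrt ((Nat.factorial (l + 1 - m) : ℝ) / (Nat.factorial (l + 1 + m) : ℝ)) := by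
  have hml : (m : ℝ) ≤ l := by exact_mod_cast hl
  have hpos : 0 < (l : ℝ) + 1 - m := by linarith
  refine mul_left_cancel₀ hpos.ne' ?_
  rw [mul_left_comm, ← sqrt_mul_sqrt_factorial_succ hl, ← mul_assoc, Real.mul_self_sqrt]
  · ring
  · nlinarith [(Nat.cast_nonneg m : (0 : ℝ) ≤ m)]

/-- three-term recurrence for the normalized derivatives of
Legendre polynomials. -/
theorem stmt_14 (m : ℕ) (l : ℕ) (hl : m ≤ l) (μ : ℝ) :
    Real.sqrt ((l : ℝ) ^ 2 - (m : ℝ) ^ 2) * pml m (l - 1) μ -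
        (2 * (l : ℝ) + 1) * μ * pml m l μ +
        Real.sqrt (((l : ℝ) + 1) ^ 2 - (m : ℝ) ^ 2) * pml m (l + 1) μ = 0 := by
  rcases l with _ | n
  · obtain rfl : m = 0 := by omega
    have h0 : legendreP 0 μ = 1 := by simp [legendreP]
    have h1 : legendreP 1 μ = μ := by
      have h := iteratedDeriv_legendreP 0 1 μ
      norm_num at h
      linarith
    simp [pml, h0, h1]
  · have hb := iteratedDeriv_legendreP_bonnet m n μ
    have hs := sqrt_mul_sqrt_factorial_succ hl
    rw [Nat.add_sub_cancel]
    have hc : Real.sqrt (((n + 1 : ℕ) : ℝ) ^ 2 - (m : ℝ) ^ 2) * pml m n μ =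
        ((n : ℝ) + 1 + m) * Real.sqrt ((Nat.factorial (n + 1 - m) : ℝ) /
          (Nat.factorial (n + 1 + m) : ℝ)) * iteratedDeriv m (legendreP n) μ := by
      rw [pml]
      rcases Nat.lt_or_ge n m with h | h
      · simp [iteratedDeriv_legendreP_eq_zero h]
      · rw [← sqrt_mul_sqrt_factorial h]
        push_cast
        ring
    rw [hc]
    simp only [pml]
    push_cast at hs ⊢
    rw [← mul_assoc (Real.sqrt (((n : ℝ) + 1 + 1) ^ 2 - (m : ℝ) ^ 2)), hs]
    linear_combination Real.sqrt ((Nat.factorial (n + 1 - m) : ℝ) /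
      (Nat.factorial (n + 1 + m) : ℝ)) * hb
end
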